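/- arXiv:2209.08134 — 2 statements merged into one kernel-verified Lean document; each statement's English description precedes it below -/
import Mathlib

section
/- There exists ε₀ > 0 such that for every ε ∈ (0, ε₀) there exists ℓ₀ such that for every ℓ ≥ ℓ₀ there exists n₀ such that the following holds for all n ≥ n₀. Let H be a 3-uniform hypergraph on n vertices that contains no pseudocycle of length m for any m ≤ ℓ with m not divisible by 3, and which has the maximum number of edges among all 3-uniform hypergraphs on n vertices with this property. Then every vertex u of H satisfies d(u) ≥ (3α − ε)n², where α = √3/3 − 1/2. -/
/-- `H` has a pseudocycle of length `ℓ`: a sequence of vertices indexed by `ZMod ℓ`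
such that every three cyclically consecutive vertices form an edge of `H`. -/
def HasPseudocycle {V : Type} [DecidableEq V] (H : Finset (Finset V)) (ℓ : ℕ) : Prop :=
  ∃ v : ZMod ℓ → V, ∀ i : ZMod ℓ, ({v i, v (i + 1), v (i + 2)} : Finset V) ∈ H

/-- `H` has no pseudocycle of length `m` for any `m ≤ ℓ` with `3 ∤ m`. -/
def NoShortOddPseudocycle {V : Type} [DecidableEq V] (H : Finset (Finset V)) (ℓ : ℕ) :
    Prop :=
  ∀ m : ℕ, 3 ≤ m → m ≤ ℓ → ¬ (3 ∣ m) → ¬ HasPseudocycle H m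

theorem numeric_step (a b n : ℝ) (ha : (3 - √3) / 2 * n ≤ a) (ha' : a ≤ (3 - √3) / 2 * n + 1)
    (hab : a + b = n) (hb : 0 ≤ b) (hn : 0 ≤ n) :
    (√3 / 3 - 1 / 2) * n ^ 3 - 10 * n ^ 2 ≤
      a * (a - 1) / 2 * b + ((√3 / 3 - 1 / 2) * b ^ 3 - 10 * b ^ 2) := by
  have hs : √3 ^ 2 = 3 := Real.sq_sqrt (by norm_num)
  have h1 : 1.7 < √3 := by
    apply Real.lt_sqrt_of_sq_lt; norm_num
  have h2 : √3 < 1.74 := by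
    rw [Real.sqrt_lt' (by norm_num)]; norm_num
  generalize √3 = s at *
  obtain ⟨x, hx⟩ : ∃ x, x = (3 - s) / 2 := ⟨_, rfl⟩
  obtain ⟨y, hy⟩ : ∃ y, y = (s - 1) / 2 := ⟨_, rfl⟩
  obtain ⟨α, hα⟩ : ∃ α, α = s / 3 - 1 / 2 := ⟨_, rfl⟩
  have hxy : x + y = 1 := by rw [hx, hy]; ring
  have key : x ^ 2 * y / 2 + α * y ^ 3 = α := by
    rw [hx, hy, hα]
    have h3 : s ^ 3 = 3 * s := by rw [pow_succ, hs]
    have h4 : s ^ 4 = 9 := by rw [show s ^ 4 = (s ^ 2) ^ 2 by ring, hs]; norm_num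
    ring_nf
    rw [h4, h3, hs]; ring
  rw [← hx] at ha ha'
  rw [← hα]
  have hx0 : 0 ≤ x := by linarith
  have hx1 : x ≤ 1 := by linarith
  have hy0 : 0 ≤ y := by linarith
  have hy1 : y ≤ 1 / 2 := by linarith
  have hα0 : 0 ≤ α := by linarith
  have hα1 : α ≤ 1 / 10 := by linarith
  obtain ⟨δ, hδ⟩ : ∃ δ, δ = y * n - b := ⟨_, rfl⟩
  have hxn : x * n + y * n = n := by rw [← add_mul, hxy, one_mul]
  have hδ0 : 0 ≤ δ := by linarith
  have hδ1 : δ ≤ 1 := by linarith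
  have hxn0 : 0 ≤ x * n := by positivity
  have hyn0 : 0 ≤ y * n := by positivity
  have hbe : b = y * n - δ := by linarith
  have e1 : (x * n) ^ 2 * b ≤ a ^ 2 * b := by gcongr
  have e2 : (x * n) ^ 2 * δ ≤ n ^ 2 := by
    have : (x * n) ^ 2 ≤ n ^ 2 := by
      apply pow_le_pow_left₀ hxn0; linarith
    calc (x * n) ^ 2 * δ ≤ n ^ 2 * 1 := by gcongr
      _ = n ^ 2 := by ring
  have e3 : a * b ≤ n ^ 2 := by
    have : a * b ≤ n * n := by
      apply mul_le_mul <;> linarith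
    nlinarith
  have hyn2 : (y * n) ^ 2 ≤ n ^ 2 / 4 := by
    have : (y * n) ^ 2 ≤ (1 / 2 * n) ^ 2 := by gcongr
    nlinarith
  have e4 : (y * n) ^ 3 - n ^ 2 ≤ b ^ 3 := by
    have q : 0 ≤ δ ^ 2 * (3 * (y * n) - δ) := by
      apply mul_nonneg (sq_nonneg _); linarith
    have q2 : (y * n) ^ 2 * δ ≤ (y * n) ^ 2 * 1 := by gcongr
    have q3 : b ^ 3 = (y * n) ^ 3 - 3 * ((y * n) ^ 2 * δ) + δ ^ 2 * (3 * (y * n) - δ) := by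
      rw [hbe]; ring
    nlinarith [sq_nonneg n]
  have e5 : b ^ 2 ≤ n ^ 2 / 4 := by
    have : b ^ 2 ≤ (y * n) ^ 2 := by
      apply pow_le_pow_left₀ hb; linarith
    linarith
  have e6 : α * ((y * n) ^ 3 - n ^ 2) ≤ α * b ^ 3 := by gcongr
  have e7 : α * n ^ 2 ≤ 1 / 10 * n ^ 2 := by gcongr
  have e8 : (x * n) ^ 2 * b = x ^ 2 * y * n ^ 3 - (x * n) ^ 2 * δ := by rw [hbe]; ring
  have e9 : α * n ^ 3 = x ^ 2 * y / 2 * n ^ 3 + α * (y * n) ^ 3 := by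
    nth_rewrite 1 [← key]; ring
  nlinarith [sq_nonneg n]

/-- All triples with two vertices in `A` and one in `B`. -/
def mixed {V : Type} [DecidableEq V] (A B : Finset V) : Finset (Finset V) :=
  ((A ∪ B).powersetCard 3).filter fun e => (e ∩ A).card = 2

theorem mixed_card {V : Type} [DecidableEq V] (A B : Finset V) (h : Disjoint A B) :
    A.card.choose 2 * B.card ≤ (mixed A B).card := by
  rw [← Finset.card_powersetCard, ← Finset.card_product]
  have hdis : ∀ b ∈ B, b ∉ A := fun b hb ha => (Finset.disjoint_left.mp h ha hb)
  have hI : ∀ p b, p ⊆ A → b ∈ B → (insert b p) ∩ A = p := by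
    intro p b hp hb
    rw [Finset.insert_inter_of_notMem (hdis b hb)]
    exact Finset.inter_eq_left.mpr hp
  apply Finset.card_le_card_of_injOn (fun q => insert q.2 q.1)
  · rintro ⟨p, b⟩ hq
    simp only [Finset.coe_product, Set.mem_prod, Finset.mem_coe, Finset.mem_powersetCard] at hq
    obtain ⟨⟨hp, hc⟩, hb⟩ := hq
    simp only [mixed, Finset.mem_coe, Finset.mem_filter, Finset.mem_powersetCard]
    refine ⟨⟨?_, ?_⟩, ?_⟩
    · apply Finset.insert_subset (Finset.mem_union_right _ hb)
      exact hp.trans Finset.subset_union_left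
    · rw [Finset.card_insert_of_notMem (fun hbp => hdis b hb (hp hbp)), hc]
    · rw [hI p b hp hb, hc]
  · rintro ⟨p, b⟩ hq ⟨p', b'⟩ hq' heq
    simp only [Finset.coe_product, Set.mem_prod, Finset.mem_coe, Finset.mem_powersetCard] at hq hq'
    obtain ⟨⟨hp, hc⟩, hb⟩ := hq
    obtain ⟨⟨hp', hc'⟩, hb'⟩ := hq'
    simp only at heq
    have hpp : p = p' := by rw [← hI p b hp hb, heq, hI p' b' hp' hb']
    subst hpp
    have : b ∈ insert b' p := heq ▸ Finset.mem_insert_self b p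
    rcases Finset.mem_insert.mp this with h1 | h1
    · rw [h1]
    · exact absurd (hp h1) (hdis b hb)

theorem inter_card_three {V : Type} [DecidableEq V] (A : Finset V) (x y z : V)
    (h : ({x, y, z} : Finset V).card = 3) :
    (({x, y, z} : Finset V) ∩ A).card =
      (if x ∈ A then 1 else 0) + (if y ∈ A then 1 else 0) + (if z ∈ A then 1 else 0) := by
  have hxy : x ≠ y := by
    rintro rfl
    simp only [Finset.mem_insert, true_or, Finset.insert_eq_of_mem] at h
    have := Finset.card_le_two (a := x) (b := z); omega
  have hxz : x ≠ z := by
    rintro rfl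
    rw [Finset.insert_eq_of_mem (by simp)] at h
    have := Finset.card_le_two (a := y) (b := x); omega
  have hyz : y ≠ z := by
    rintro rfl
    rw [Finset.pair_eq_singleton] at h
    have := Finset.card_le_two (a := x) (b := y); omega
  rw [← Finset.filter_mem_eq_inter, Finset.card_filter, Finset.sum_insert (by simp [hxy, hxz]),
    Finset.sum_insert (by simp [hyz]), Finset.sum_singleton, add_assoc]

theorem no_pseudo_union {V : Type} [DecidableEq V] (A B : Finset V) (h : Disjoint A B)
    (K : Finset (Finset V)) (hK : ∀ e ∈ K, e.card = 3 ∧ e ⊆ B)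
    (hp : ∀ m : ℕ, ¬ 3 ∣ m → ¬ HasPseudocycle K m) (m : ℕ) (hm : ¬ 3 ∣ m) :
    ¬ HasPseudocycle (mixed A B ∪ K) m := by
  rintro ⟨v, hv⟩
  have : NeZero m := ⟨by rintro rfl; simp at hm⟩
  let c : ZMod m → ℕ := fun i => if v i ∈ A then 1 else 0
  have hc1 : ∀ i, c i ≤ 1 := fun i => by simp only [c]; split_ifs <;> simp
  have hs : ∀ i, c i + c (i + 1) + c (i + 2) = 2 ∨
      (c i + c (i + 1) + c (i + 2) = 0 ∧ ({v i, v (i + 1), v (i + 2)} : Finset V) ∈ K) := by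
    intro i
    rcases Finset.mem_union.mp (hv i) with h1 | h1
    · left
      simp only [mixed, Finset.mem_filter, Finset.mem_powersetCard] at h1
      rw [← h1.2, inter_card_three A _ _ _ h1.1.2]
    · right
      refine ⟨?_, h1⟩
      have h2 := hK _ h1
      have := inter_card_three A _ _ _ h2.1
      change _ = c i + c (i + 1) + c (i + 2) at this
      rw [← this, Finset.card_eq_zero, ← Finset.disjoint_iff_inter_eq_empty]
      exact (h.mono_right h2.2).symm
  by_cases h0 : ∃ i, c i + c (i + 1) + c (i + 2) = 0
  · obtain ⟨i, hi⟩ := h0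
    have hall : ∀ k : ℕ, c (i + k) + c (i + k + 1) + c (i + k + 2) = 0 := by
      intro k
      induction k with
      | zero => simpa using hi
      | succ k ih =>
        have e1 : i + ((k + 1 : ℕ) : ZMod m) = i + k + 1 := by push_cast; ring
        have e2 : i + (k : ZMod m) + 1 + 1 = i + k + 2 := by ring
        rw [e1]
        have := hs (i + k + 1)
        rw [e2] at this ⊢
        have := hc1 (i + k + 1 + 2)
        omega
    apply hp m hm
    refine ⟨v, fun j => ?_⟩
    have hj := hall (j - i).val
    rw [ZMod.natCast_zmod_val, add_sub_cancel] at hj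
    rcases hs j with h1 | h1
    · omega
    · exact h1.2
  · push Not at h0
    have hall : ∀ i, c i + c (i + 1) + c (i + 2) = 2 := by
      intro i
      rcases hs i with h1 | h1
      · exact h1
      · exact absurd h1.1 (h0 i)
    have hsum : ∑ i, (c i + c (i + 1) + c (i + 2)) = ∑ i : ZMod m, 2 :=
      Finset.sum_congr rfl fun i _ => hall i
    rw [Finset.sum_add_distrib, Finset.sum_add_distrib] at hsum
    have t1 : ∑ i, c (i + 1) = ∑ i, c i := Equiv.sum_comp (Equiv.addRight (1 : ZMod m)) c
    have t2 : ∑ i, c (i + 2) = ∑ i, c i := Equiv.sum_comp (Equiv.addRight (2 : ZMod m)) c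
    rw [t1, t2] at hsum
    simp only [Finset.sum_const, Finset.card_univ, ZMod.card, smul_eq_mul] at hsum
    omega

theorem construction {V : Type} [DecidableEq V] : ∀ (n : ℕ) (S : Finset V), S.card = n →
    ∃ H : Finset (Finset V), (∀ e ∈ H, e.card = 3 ∧ e ⊆ S) ∧
      (∀ m : ℕ, ¬ 3 ∣ m → ¬ HasPseudocycle H m) ∧
      (√3 / 3 - 1 / 2) * (n : ℝ) ^ 3 - 10 * (n : ℝ) ^ 2 ≤ (H.card : ℝ) := by
  intro n
  induction n using Nat.strong_induction_on with
  | _ n ih =>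
  intro S hS
  rcases Nat.eq_zero_or_pos n with rfl | hn
  · refine ⟨∅, by simp, ?_, by simp⟩
    rintro m hm ⟨v, hv⟩
    simpa using hv 0
  have h1 : 1.7 < √3 := by
    apply Real.lt_sqrt_of_sq_lt; norm_num
  have h2 : √3 < 1.74 := by
    rw [Real.sqrt_lt' (by norm_num)]; norm_num
  have hn' : (0 : ℝ) < n := by exact_mod_cast hn
  have hx0 : 0 < (3 - √3) / 2 * n := by
    apply mul_pos _ hn'; linarith
  obtain ⟨a, ha⟩ : ∃ a, a = ⌈(3 - √3) / 2 * n⌉₊ := ⟨_, rfl⟩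
  have ha1 : (3 - √3) / 2 * n ≤ a := ha ▸ Nat.le_ceil _
  have ha2 : (a : ℝ) ≤ (3 - √3) / 2 * n + 1 := ha ▸ (Nat.ceil_lt_add_one hx0.le).le
  have ha3 : 0 < a := ha ▸ Nat.ceil_pos.mpr hx0
  have ha4 : a ≤ n := by
    rw [ha]; apply Nat.ceil_le.mpr; nlinarith
  obtain ⟨A, hAS, hA⟩ := Finset.exists_subset_card_eq (hS ▸ ha4 : a ≤ S.card)
  have hB : (S \ A).card = n - a := by rw [Finset.card_sdiff_of_subset hAS, hS, hA]
  obtain ⟨K, hK, hp, hcard⟩ := ih (n - a) (by omega) (S \ A) hB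
  have hdis : Disjoint A (S \ A) := Finset.disjoint_sdiff
  refine ⟨mixed A (S \ A) ∪ K, ?_, no_pseudo_union A (S \ A) hdis K hK hp, ?_⟩
  · intro e he
    rcases Finset.mem_union.mp he with h | h
    · simp only [mixed, Finset.mem_filter, Finset.mem_powersetCard] at h
      refine ⟨h.1.2, ?_⟩
      rw [← Finset.union_sdiff_of_subset hAS]; exact h.1.1
    · exact ⟨(hK e h).1, (hK e h).2.trans Finset.sdiff_subset⟩
  · have hd2 : Disjoint (mixed A (S \ A)) K := by
      rw [Finset.disjoint_left]
      intro e he heK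
      simp only [mixed, Finset.mem_filter, Finset.mem_powersetCard] at he
      have : e ∩ A = ∅ := by
        rw [← Finset.disjoint_iff_inter_eq_empty]
        exact (hdis.mono_right (hK e heK).2).symm
      rw [this] at he
      simp at he
    rw [Finset.card_union_of_disjoint hd2]
    have hm := mixed_card A (S \ A) hdis
    rw [hA, hB] at hm
    have hm' : ((a.choose 2 * (n - a) : ℕ) : ℝ) ≤ ((mixed A (S \ A)).card : ℝ) := by
      exact_mod_cast hm
    rw [Nat.cast_mul, Nat.cast_choose_two] at hm'
    have := numeric_step a ((n - a : ℕ) : ℝ) n ha1 ha2 (by push_cast [ha4]; ring)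
      (Nat.cast_nonneg _) hn'.le
    push_cast at *
    linarith

theorem degree_compare {n : ℕ} (ℓ : ℕ) (H : Finset (Finset (Fin n))) (h3 : ∀ e ∈ H, e.card = 3)
    (hno : NoShortOddPseudocycle H ℓ)
    (hmax : ∀ H' : Finset (Finset (Fin n)), (∀ e ∈ H', e.card = 3) →
              NoShortOddPseudocycle H' ℓ → H'.card ≤ H.card) (u v : Fin n) :
    (H.filter fun e => v ∈ e).card ≤ (H.filter fun e => u ∈ e).card + n := by
  by_cases huv : u = v
  · subst huv; omega
  let P := H.filter fun e => u ∉ e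
  let Q := H.filter fun e => v ∈ e ∧ u ∉ e
  let g : Finset (Fin n) → Finset (Fin n) := fun e => insert u (e.erase v)
  let f : Fin n → Fin n := fun x => if x = u then v else x
  have hfid : ∀ e : Finset (Fin n), u ∉ e → e.image f = e := by
    intro e he
    have : Set.EqOn f id e := by
      intro x hx
      have : x ≠ u := by rintro rfl; exact he hx
      simp [f, this]
    rw [Finset.image_congr this, Finset.image_id]
  have hfg : ∀ e ∈ Q, (g e).image f = e := by
    intro e he
    simp only [Q, Finset.mem_filter] at he
    simp only [g]
    rw [Finset.image_insert, hfid _ (fun h => he.2.2 (Finset.mem_of_mem_erase h))]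
    simp only [f, if_true]
    exact Finset.insert_erase he.2.1
  have hle : (P ∪ Q.image g).card ≤ H.card := by
    apply hmax
    · intro e he
      rcases Finset.mem_union.mp he with h | h
      · exact h3 e (Finset.mem_filter.mp h).1
      · obtain ⟨e, heQ, rfl⟩ := Finset.mem_image.mp h
        simp only [Q, Finset.mem_filter] at heQ
        simp only [g]
        rw [Finset.card_insert_of_notMem (fun h => heQ.2.2 (Finset.mem_of_mem_erase h)),
          Finset.card_erase_of_mem heQ.2.1, h3 e heQ.1]
    · rintro m hm hml hm3 ⟨w, hw⟩
      apply hno m hm hml hm3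
      refine ⟨f ∘ w, fun i => ?_⟩
      have himg : ({(f ∘ w) i, (f ∘ w) (i + 1), (f ∘ w) (i + 2)} : Finset (Fin n)) =
          ({w i, w (i + 1), w (i + 2)} : Finset (Fin n)).image f := by
        simp [Finset.image_insert]
      rw [himg]
      rcases Finset.mem_union.mp (hw i) with h | h
      · rw [hfid _ (Finset.mem_filter.mp h).2]; exact (Finset.mem_filter.mp h).1
      · obtain ⟨e, heQ, he⟩ := Finset.mem_image.mp h
        rw [← he, hfg e heQ]
        exact (Finset.mem_filter.mp heQ).1
  have hdis : Disjoint P (Q.image g) := by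
    rw [Finset.disjoint_left]
    intro e he h
    obtain ⟨e', -, rfl⟩ := Finset.mem_image.mp h
    exact (Finset.mem_filter.mp he).2 (Finset.mem_insert_self _ _)
  have hinj : Set.InjOn g Q := by
    intro e he e' he' h
    rw [← hfg e he, h, hfg e' he']
  rw [Finset.card_union_of_disjoint hdis, Finset.card_image_of_injOn hinj] at hle
  have hP : (H.filter fun e => u ∈ e).card + P.card = H.card :=
    Finset.card_filter_add_card_filter_not _
  have hsub : (H.filter fun e => v ∈ e) ⊆
      Q ∪ (Finset.univ.image fun x : Fin n => ({u, v, x} : Finset (Fin n))) := by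
    intro e he
    obtain ⟨heH, hve⟩ := Finset.mem_filter.mp he
    by_cases hue : u ∈ e
    · apply Finset.mem_union_right
      have hc : ((e.erase u).erase v).card = 1 := by
        rw [Finset.card_erase_of_mem (Finset.mem_erase.mpr ⟨Ne.symm huv, hve⟩),
          Finset.card_erase_of_mem hue, h3 e heH]
      obtain ⟨x, hx⟩ := Finset.card_eq_one.mp hc
      refine Finset.mem_image.mpr ⟨x, Finset.mem_univ _, ?_⟩
      rw [← hx, Finset.insert_erase (Finset.mem_erase.mpr ⟨Ne.symm huv, hve⟩),
        Finset.insert_erase hue]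
    · exact Finset.mem_union_left _ (Finset.mem_filter.mpr ⟨heH, hve, hue⟩)
  have h4 := Finset.card_le_card hsub
  have h5 := Finset.card_union_le Q (Finset.univ.image fun x : Fin n => ({u, v, x} : Finset (Fin n)))
  have h6 : (Finset.univ.image fun x : Fin n => ({u, v, x} : Finset (Fin n))).card ≤ n := by
    simpa using Finset.card_image_le (s := Finset.univ)
      (f := fun x : Fin n => ({u, v, x} : Finset (Fin n)))
  omega

theorem degree_sum {n : ℕ} (H : Finset (Finset (Fin n))) (h3 : ∀ e ∈ H, e.card = 3) :
    ∑ v, (H.filter fun e => v ∈ e).card = 3 * H.card := by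
  simp_rw [Finset.card_filter]
  rw [Finset.sum_comm]
  have : ∀ e ∈ H, (∑ v, if v ∈ e then 1 else 0) = 3 := by
    intro e he
    simp [h3 e he]
  rw [Finset.sum_congr rfl this]
  simp [mul_comm]

/-- Minimum degree of extremal hypergraphs with no short odd pseudocycles:
every vertex has degree at least `(3α − ε)n²`, where `α = √3/3 − 1/2`. -/
theorem min_degree_of_extremal :
    ∃ ε₀ : ℝ, 0 < ε₀ ∧ ∀ ε : ℝ, 0 < ε → ε < ε₀ →
      ∃ ℓ₀ : ℕ, ∀ ℓ : ℕ, ℓ₀ ≤ ℓ →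
        ∃ n₀ : ℕ, ∀ n : ℕ, n₀ ≤ n →
          ∀ H : Finset (Finset (Fin n)), (∀ e ∈ H, e.card = 3) →
            NoShortOddPseudocycle H ℓ →
            (∀ H' : Finset (Finset (Fin n)), (∀ e ∈ H', e.card = 3) →
              NoShortOddPseudocycle H' ℓ → H'.card ≤ H.card) →
            ∀ u : Fin n,
              ((H.filter fun e => u ∈ e).card : ℝ)
                ≥ (3 * (Real.sqrt 3 / 3 - 1 / 2) - ε) * (n : ℝ) ^ 2 := by
  refine ⟨1, one_pos, fun ε hε _ => ⟨0, fun ℓ _ => ⟨⌈31 / ε⌉₊ + 1, ?_⟩⟩⟩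
  intro n hn H h3 hno hmax u
  obtain ⟨K, hK, hp, hcard⟩ := construction n (Finset.univ : Finset (Fin n)) (by simp)
  have hKH : K.card ≤ H.card :=
    hmax K (fun e he => (hK e he).1) (fun m _ _ hm => hp m hm)
  have hsum : 3 * H.card ≤ n * ((H.filter fun e => u ∈ e).card + n) := by
    rw [← degree_sum H h3]
    calc ∑ v, (H.filter fun e => v ∈ e).card
        ≤ ∑ _v : Fin n, ((H.filter fun e => u ∈ e).card + n) :=
          Finset.sum_le_sum fun v _ => degree_compare ℓ H h3 hno hmax u v
      _ = _ := by simp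
  have hnpos : (0 : ℝ) < n := by
    have : 0 < n := by omega
    exact_mod_cast this
  have hnε : 31 ≤ ε * n := by
    have h1 : 31 / ε ≤ n := by
      have h2 := Nat.le_ceil (31 / ε)
      have h3 : ((⌈31 / ε⌉₊ : ℕ) : ℝ) ≤ n := by exact_mod_cast (by omega)
      linarith
    rw [div_le_iff₀ hε] at h1
    linarith
  have hKH' : (K.card : ℝ) ≤ H.card := by exact_mod_cast hKH
  have hsum' : 3 * (H.card : ℝ) ≤ n * (((H.filter fun e => u ∈ e).card : ℝ) + n) := by
    exact_mod_cast hsum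
  have key : (n : ℝ) * (3 * (√3 / 3 - 1 / 2) * (n : ℝ) ^ 2 - 30 * n) ≤
      n * (((H.filter fun e => u ∈ e).card : ℝ) + n) := by nlinarith
  have key2 := le_of_mul_le_mul_left key hnpos
  have : 31 * (n : ℝ) ≤ ε * n * n := by gcongr
  nlinarith
end

section
/- There exists ε₂⁰ > 0 such that for every ε₂ ∈ (0, ε₂⁰) there exists ε₁⁰ > 0 such that for every ε₁ ∈ (0, ε₁⁰) there exists ℓ₀ such that for every ℓ ≥ ℓ₀ there exists n₀ such that the following holds for all n ≥ n₀. Let H be a 3-uniform hypergraph on n vertices that contains no pseudocycle of length m for any m ≤ ℓ with m not divisible by 3, and suppose e(H) ≥ f(n) − ε₁n³. Then every vertex u of H satisfies d(u) ≤ (3α + ε₂)n², where α = √3/3 − 1/2. -/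
/-- `f 0 = f 1 = 0` and, for `n ≥ 2`,
`f n = max over 1 ≤ k ≤ n − 1 of (k choose 2)·(n − k) + f (n − k)`
(here `k = j + 1` ranges over `1, …, n − 1`). -/
def f : ℕ → ℕ
  | 0 => 0
  | 1 => 0
  | n + 2 =>
    (Finset.range (n + 1)).sup fun j =>
      Nat.choose (j + 1) 2 * (n + 1 - j) + f (n + 1 - j)
  decreasing_by omega
/-! ### Closed walks in a finite digraph -/

lemma short_closed_walk {β : Type} [Fintype β] (R : β → β → Prop) :
    ∀ (m : ℕ) (v : ℕ → β), v 0 = v m → (∀ i < m, R (v i) (v (i + 1))) → ¬ (3 ∣ m) →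
      ∃ m' ≤ Fintype.card β, ¬ (3 ∣ m') ∧ ∃ v' : ℕ → β, v' 0 = v' m' ∧
        ∀ i < m', R (v' i) (v' (i + 1)) := by
  intro m
  induction m using Nat.strong_induction_on with
  | _ m ih =>
    intro v h0 hR h3
    by_cases hm : m ≤ Fintype.card β
    · exact ⟨m, hm, h3, v, h0, hR⟩
    push Not at hm
    obtain ⟨a, b, hab, hv⟩ := Fintype.exists_ne_map_eq_of_card_lt (fun i : Fin m => v i)
      (by simpa using hm)
    have key : ∃ i j : ℕ, i < j ∧ j < m ∧ v i = v j := by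
      rcases lt_or_gt_of_ne (fun h => hab (Fin.ext h) : (a : ℕ) ≠ b) with h | h
      · exact ⟨a, b, h, b.2, hv⟩
      · exact ⟨b, a, h, a.2, hv.symm⟩
    obtain ⟨i, j, hij, hjm, hvij⟩ := key
    by_cases hd : 3 ∣ (j - i)
    · refine ih (m - (j - i)) (by omega) (fun t => if t ≤ i then v t else v (t + (j - i))) ?_ ?_ ?_
      · have h1 : ¬ (m - (j - i) ≤ i) := by omega
        have h2 : m - (j - i) + (j - i) = m := by omega
        simp only [Nat.zero_le, if_true, h1, if_false, h2, h0]
      · intro t ht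
        rcases lt_trichotomy t i with h | h | h
        · have h1 : t ≤ i := by omega
          have h2 : t + 1 ≤ i := by omega
          simp only [h1, h2, if_true]
          exact hR t (by omega)
        · subst h
          have h2 : ¬ (t + 1 ≤ t) := by omega
          have h3 : t + 1 + (j - t) = j + 1 := by omega
          simp only [le_refl, if_true, h2, if_false, h3, hvij]
          exact hR j hjm
        · have h1 : ¬ (t ≤ i) := by omega
          have h2 : ¬ (t + 1 ≤ i) := by omega
          have h3 : t + 1 + (j - i) = t + (j - i) + 1 := by omega
          simp only [h1, h2, if_false, h3]
          exact hR _ (by omega)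
      · omega
    · refine ih (j - i) (by omega) (fun t => v (i + t)) ?_ ?_ hd
      · have h2 : i + (j - i) = j := by omega
        simp only [h2, add_zero, hvij]
      · intro t ht
        exact hR (i + t) (by omega)

/-- Walks of length `k` from `p` to `q`. -/
def Wlk {β : Type} (R : β → β → Prop) : ℕ → β → β → Prop
  | 0, p, q => p = q
  | k + 1, p, q => ∃ r, R p r ∧ Wlk R k r q

lemma Wlk.trans {β : Type} {R : β → β → Prop} {l : ℕ} {q r : β} :
    ∀ {k : ℕ} {p : β}, Wlk R k p q → Wlk R l q r → Wlk R (k + l) p r := by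
  intro k
  induction k with
  | zero => intro p h1 h2; cases h1; simpa using h2
  | succ k ih =>
    rintro p ⟨s, hs, h1⟩ h2
    rw [Nat.succ_add]
    exact ⟨s, hs, ih h1 h2⟩

lemma Wlk.toFun {β : Type} {R : β → β → Prop} {q : β} :
    ∀ {k : ℕ} {p : β}, Wlk R k p q →
      ∃ v : ℕ → β, v 0 = p ∧ v k = q ∧ ∀ i < k, R (v i) (v (i + 1)) := by
  intro k
  induction k with
  | zero => intro p h; exact ⟨fun _ => p, rfl, h, by simp⟩
  | succ k ih =>
    rintro p ⟨s, hs, h1⟩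
    obtain ⟨v, h0, hk, hv⟩ := ih h1
    refine ⟨fun i => Nat.casesOn i p v, rfl, hk, ?_⟩
    intro i hi
    cases i with
    | zero => simpa [h0] using hs
    | succ i => exact hv i (by omega)

lemma exists_label {β : Type} (R : β → β → Prop)
    (hC : ∀ (m : ℕ) (v : ℕ → β), v 0 = v m → (∀ i < m, R (v i) (v (i + 1))) → 3 ∣ m)
    (hs : ∀ p q, R p q → ∃ r, R q r ∧ R r p) :
    ∃ φ : β → ZMod 3, ∀ p q, R p q → φ q = φ p + 1 := by
  classical
  have hrev : ∀ (k : ℕ) (p q : β), Wlk R k p q → ∃ l, Wlk R l q p := by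
    intro k
    induction k with
    | zero => intro p q h; exact ⟨0, h.symm⟩
    | succ k ih =>
      rintro p q ⟨s, hps, h⟩
      obtain ⟨l, hl⟩ := ih s q h
      obtain ⟨r, h1, h2⟩ := hs p s hps
      exact ⟨l + 2, hl.trans ⟨r, h1, p, h2, rfl⟩⟩
  have hcl : ∀ (k : ℕ) (p : β), Wlk R k p p → 3 ∣ k := by
    intro k p h
    obtain ⟨v, h0, hk, hv⟩ := h.toFun
    exact hC k v (h0.trans hk.symm) hv
  let S : Setoid β :=
    { r := fun p q => ∃ k, Wlk R k p q
      iseqv :=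
        { refl := fun p => ⟨0, rfl⟩
          symm := fun ⟨k, h⟩ => hrev k _ _ h
          trans := fun ⟨k, h⟩ ⟨l, h'⟩ => ⟨k + l, h.trans h'⟩ } }
  let root : β → β := fun p => (Quotient.mk S p).out
  have hroot : ∀ p, ∃ k, Wlk R k (root p) p := fun p => Quotient.mk_out (s := S) p
  have hrooteq : ∀ p q, R p q → root p = root q := by
    intro p q h
    have : Quotient.mk S p = Quotient.mk S q := Quotient.sound ⟨1, q, h, rfl⟩
    simp only [root, this]
  choose d hd using hroot
  refine ⟨fun p => (d p : ZMod 3), ?_⟩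
  intro p q h
  have h1 : Wlk R (d p + 1) (root p) q := (hd p).trans ⟨q, h, rfl⟩
  have h2 : Wlk R (d q) (root p) q := by rw [hrooteq p q h]; exact hd q
  obtain ⟨l, hl⟩ := hrev _ _ _ h2
  have a1 := hcl _ _ (h1.trans hl)
  have a2 := hcl _ _ (h2.trans hl)
  have a1' : ((d p + 1 + l : ℕ) : ZMod 3) = 0 := (ZMod.natCast_eq_zero_iff _ _).2 a1
  have a2' : ((d q + l : ℕ) : ZMod 3) = 0 := (ZMod.natCast_eq_zero_iff _ _).2 a2
  push_cast at a1' a2'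
  linear_combination a2' - a1'

/-! ### Labelling of ordered pairs -/

lemma no_closed_walk {V : Type} [DecidableEq V] (H : Finset (Finset V))
    (hH : ∀ e ∈ H, e.card = 3) (ℓ : ℕ)
    (hP : ∀ m : ℕ, 3 ≤ m → m ≤ ℓ → ¬ (3 ∣ m) → ¬ HasPseudocycle H m)
    (v : ℕ → V × V) (m : ℕ) (hm : m ≤ ℓ) (h3 : ¬ 3 ∣ m) (h0 : v 0 = v m)
    (hv : ∀ i < m, (v i).2 = (v (i + 1)).1 ∧
      ({(v i).1, (v i).2, (v (i + 1)).2} : Finset V) ∈ H) : False := by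
  have hm3 : 3 ≤ m := by
    by_contra hlt
    have : m = 0 ∨ m = 1 ∨ m = 2 := by omega
    rcases this with rfl | rfl | rfl
    · simp at h3
    · obtain ⟨h1, h2⟩ := hv 0 (by norm_num)
      have h4 := hH _ h2
      simp only [zero_add] at *
      rw [← h0] at h4
      have : ({(v 0).1, (v 0).2, (v 0).2} : Finset V).card ≤ 2 := by
        simpa using Finset.card_le_two
      omega
    · obtain ⟨h1, h2⟩ := hv 0 (by norm_num)
      obtain ⟨h1', h2'⟩ := hv 1 (by norm_num)
      have h4 := hH _ h2
      simp only [zero_add, Nat.reduceAdd] at *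
      rw [h1', ← h0] at h4
      have : ({(v 0).1, (v 0).2, (v 0).1} : Finset V).card ≤ 2 := by
        rw [Finset.insert_eq_of_mem (by simp)]
        exact Finset.card_le_two
      omega
  refine hP m hm3 hm h3 ?_
  have : NeZero m := ⟨by omega⟩
  have step : ∀ i : ZMod m, (v i.val).2 = (v (i + 1).val).1 ∧
      ({(v i.val).1, (v i.val).2, (v (i + 1).val).2} : Finset V) ∈ H := by
    intro i
    have hi := ZMod.val_lt i
    have hval : v (i + 1).val = v (i.val + 1) := by
      have : Fact (1 < m) := ⟨by omega⟩
      rw [ZMod.val_add, ZMod.val_one]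
      rcases Nat.lt_or_ge (i.val + 1) m with h | h
      · rw [Nat.mod_eq_of_lt h]
      · have : i.val + 1 = m := by omega
        rw [this, Nat.mod_self, h0]
    rw [hval]
    exact hv _ hi
  refine ⟨fun i => (v i.val).1, fun i => ?_⟩
  have h1 := step i
  have h2 := step (i + 1)
  have h12 : i + 1 + 1 = i + 2 := by ring
  rw [h12] at h2
  simp only
  rw [← h2.1, ← h1.1]
  exact h1.2

lemma exists_orientation {V : Type} [DecidableEq V] (H : Finset (Finset V))
    (hH : ∀ e ∈ H, e.card = 3) (ℓ : ℕ)
    (hP : ∀ m : ℕ, 3 ≤ m → m ≤ ℓ → ¬ (3 ∣ m) → ¬ HasPseudocycle H m)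
    (S : Finset V) (hS : S.card ^ 2 ≤ ℓ) :
    ∃ ψ : S → S → ZMod 3, (∀ x y, ψ y x = - ψ x y) ∧
      ∀ x y z : S, ({x.1, y.1, z.1} : Finset V) ∈ H → ψ y z = ψ x y + 1 := by
  let R : S × S → S × S → Prop := fun p q =>
    p.2 = q.1 ∧ ({p.1.1, p.2.1, q.2.1} : Finset V) ∈ H
  have perm1 : ∀ x y z : V, ({y, z, x} : Finset V) = {x, y, z} := by
    intro x y z; ext a; simp; tauto
  have perm2 : ∀ x y z : V, ({z, y, x} : Finset V) = {x, y, z} := by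
    intro x y z; ext a; simp; tauto
  obtain ⟨φ, hφ⟩ := exists_label R (by
    intro m v h0 hv
    by_contra h3
    obtain ⟨m', hm', h3', v', h0', hv'⟩ := short_closed_walk R m v h0 hv h3
    have hm'' : m' ≤ ℓ := by
      refine hm'.trans (le_trans (le_of_eq ?_) hS)
      simp [sq]
    refine no_closed_walk H hH ℓ hP (fun i => ((v' i).1.1, (v' i).2.1)) m' hm'' h3' ?_ ?_
    · simp only [h0']
    · intro i hi
      obtain ⟨a, b⟩ := hv' i hi
      exact ⟨congrArg Subtype.val a, b⟩) (by
    rintro ⟨x, y⟩ ⟨y', z⟩ ⟨h1, h2⟩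
    simp only at h1 h2
    subst h1
    refine ⟨(z, x), ⟨rfl, ?_⟩, ⟨rfl, ?_⟩⟩
    · simp only; rw [perm1]; exact h2
    · simp only; rw [← perm1]; exact h2)
  have hstep : ∀ x y z : S, ({x.1, y.1, z.1} : Finset V) ∈ H → φ (y, z) = φ (x, y) + 1 :=
    fun x y z h => hφ (x, y) (y, z) ⟨rfl, h⟩
  have three : ∀ a : ZMod 3, 3 * a = 0 := by decide
  refine ⟨fun x y => φ (x, y) + (φ (x, y) + φ (y, x)), ?_, ?_⟩
  · intro x y
    linear_combination three (φ (x, y)) + three (φ (y, x))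
  · intro x y z h
    have h1 := hstep x y z h
    have h2 := hstep z y x (by rw [perm2]; exact h)
    simp only
    rw [h1, h2]; ring

/-! ### The weighted extremal problem -/

/-- indicator of the pattern `x → z ← y` with `x, y` nonadjacent. -/
def pat {V : Type} (ψ : V → V → ZMod 3) (x y z : V) : ℝ :=
  if ψ x z = 1 ∧ ψ y z = 1 ∧ ψ x y = 0 then 1 else 0

/-- The trilinear pattern form. -/
def tri {V : Type} [Fintype V] (ψ : V → V → ZMod 3) (a b c : V → ℝ) : ℝ :=
  ∑ x, ∑ y, ∑ z, pat ψ x y z * a x * b y * c z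

set_option linter.unusedSectionVars false

section
variable {V : Type} [Fintype V] (ψ : V → V → ZMod 3)

lemma pat_nonneg (x y z : V) : 0 ≤ pat ψ x y z := by
  unfold pat; split_ifs <;> norm_num

lemma tri_add1 (a a' b c : V → ℝ) : tri ψ (a + a') b c = tri ψ a b c + tri ψ a' b c := by
  simp only [tri, Pi.add_apply, ← Finset.sum_add_distrib]
  refine Finset.sum_congr rfl fun x _ => Finset.sum_congr rfl fun y _ =>
    Finset.sum_congr rfl fun z _ => by ring

lemma tri_add2 (a b b' c : V → ℝ) : tri ψ a (b + b') c = tri ψ a b c + tri ψ a b' c := by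
  simp only [tri, Pi.add_apply, ← Finset.sum_add_distrib]
  refine Finset.sum_congr rfl fun x _ => Finset.sum_congr rfl fun y _ =>
    Finset.sum_congr rfl fun z _ => by ring

lemma tri_add3 (a b c c' : V → ℝ) : tri ψ a b (c + c') = tri ψ a b c + tri ψ a b c' := by
  simp only [tri, Pi.add_apply, ← Finset.sum_add_distrib]
  refine Finset.sum_congr rfl fun x _ => Finset.sum_congr rfl fun y _ =>
    Finset.sum_congr rfl fun z _ => by ring

lemma tri_smul1 (t : ℝ) (a b c : V → ℝ) : tri ψ (t • a) b c = t * tri ψ a b c := by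
  simp only [tri, Pi.smul_apply, smul_eq_mul, Finset.mul_sum]
  refine Finset.sum_congr rfl fun x _ => Finset.sum_congr rfl fun y _ =>
    Finset.sum_congr rfl fun z _ => by ring

lemma tri_smul2 (t : ℝ) (a b c : V → ℝ) : tri ψ a (t • b) c = t * tri ψ a b c := by
  simp only [tri, Pi.smul_apply, smul_eq_mul, Finset.mul_sum]
  refine Finset.sum_congr rfl fun x _ => Finset.sum_congr rfl fun y _ =>
    Finset.sum_congr rfl fun z _ => by ring

lemma tri_smul3 (t : ℝ) (a b c : V → ℝ) : tri ψ a b (t • c) = t * tri ψ a b c := by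
  simp only [tri, Pi.smul_apply, smul_eq_mul, Finset.mul_sum]
  refine Finset.sum_congr rfl fun x _ => Finset.sum_congr rfl fun y _ =>
    Finset.sum_congr rfl fun z _ => by ring

lemma tri_zero_of (a b c : V → ℝ)
    (h : ∀ x y z, a x ≠ 0 → b y ≠ 0 → c z ≠ 0 → pat ψ x y z = 0) : tri ψ a b c = 0 := by
  unfold tri
  refine Finset.sum_eq_zero fun x _ => Finset.sum_eq_zero fun y _ =>
    Finset.sum_eq_zero fun z _ => ?_
  by_cases ha : a x = 0
  · simp [ha]
  by_cases hb : b y = 0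
  · simp [hb]
  by_cases hc : c z = 0
  · simp [hc]
  simp [h x y z ha hb hc]

variable [DecidableEq V]

lemma tri_single12 (i j : V) (c : V → ℝ) :
    tri ψ (Pi.single i 1) (Pi.single j 1) c = ∑ z, pat ψ i j z * c z := by
  unfold tri
  rw [Finset.sum_eq_single i, Finset.sum_eq_single j]
  · simp
  · intro b _ hb; simp [hb]
  · simp
  · intro b _ hb; simp [hb]
  · simp

lemma psi_self (hψ : ∀ x y, ψ y x = - ψ x y) (x : V) : ψ x x = 0 := by
  have h := hψ x x
  revert h
  generalize ψ x x = a
  revert a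
  decide

lemma single_ne {i x : V} (h : (Pi.single i (1 : ℝ) : V → ℝ) x ≠ 0) : x = i := by
  by_contra hne
  exact h (by simp [hne])

/-- expansion along two nonadjacent vertices -/
lemma tri_expand2 (hψ : ∀ x y, ψ y x = - ψ x y) (r : V → ℝ) (i j : V) (hij : ψ i j = 0) (a b : ℝ) :
    tri ψ (r + a • Pi.single i 1 + b • Pi.single j 1) (r + a • Pi.single i 1 + b • Pi.single j 1)
      (r + a • Pi.single i 1 + b • Pi.single j 1) =
    tri ψ r r r
      + a * (tri ψ (Pi.single i 1) r r + tri ψ r (Pi.single i 1) r + tri ψ r r (Pi.single i 1))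
      + b * (tri ψ (Pi.single j 1) r r + tri ψ r (Pi.single j 1) r + tri ψ r r (Pi.single j 1))
      + a ^ 2 * (∑ z, pat ψ i i z * r z) + b ^ 2 * (∑ z, pat ψ j j z * r z)
      + a * b * (∑ z, pat ψ i j z * r z + ∑ z, pat ψ j i z * r z) := by
  have hji : ψ j i = 0 := by rw [hψ i j, hij, neg_zero]
  have hii := psi_self ψ hψ i
  have hjj := psi_self ψ hψ j
  have z1 : ∀ (p q : V) (_ : ψ p q = 0) (b : V → ℝ),
      tri ψ (Pi.single p 1) b (Pi.single q 1) = 0 := by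
    intro p q hpq b
    refine tri_zero_of ψ _ _ _ fun x y z hx _ hz => ?_
    rw [single_ne hx, single_ne hz]
    simp [pat, hpq]
  have z2 : ∀ (p q : V) (_ : ψ p q = 0) (b : V → ℝ),
      tri ψ b (Pi.single p 1) (Pi.single q 1) = 0 := by
    intro p q hpq b
    refine tri_zero_of ψ _ _ _ fun x y z _ hy hz => ?_
    rw [single_ne hy, single_ne hz]
    simp [pat, hpq]
  simp only [tri_add1, tri_add2, tri_add3, tri_smul1, tri_smul2, tri_smul3,
    z1 i i hii, z1 i j hij, z1 j i hji, z1 j j hjj, z2 i i hii, z2 i j hij, z2 j i hji, z2 j j hjj,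
    tri_single12]
  ring

lemma tri_le (hψ : ∀ x y, ψ y x = - ψ x y) (A : ℝ) (hA : 0 ≤ A)
    (hquad : ∀ a s : ℝ, 0 ≤ a → 0 ≤ s → a ^ 2 * s + A * s ^ 3 ≤ A * (s + a) ^ 3) :
    ∀ (k : ℕ) (w : V → ℝ), (∀ x, 0 ≤ w x) → (Finset.univ.filter fun x => w x ≠ 0).card ≤ k →
      tri ψ w w w ≤ A * (∑ x, w x) ^ 3 := by
  intro k
  induction k with
  | zero =>
    intro w hw hk
    have h0 : ∀ x, w x = 0 := by
      intro x
      by_contra hx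
      have : x ∈ (Finset.univ.filter fun x => w x ≠ 0) := by simp [hx]
      rw [Finset.card_eq_zero.1 (Nat.le_zero.1 hk)] at this
      simp at this
    rw [tri_zero_of]
    · have : 0 ≤ ∑ x, w x := Finset.sum_nonneg fun x _ => hw x
      positivity
    · intro x y z hx; exact absurd (h0 x) hx
  | succ k ih =>
    intro w hw hk
    by_cases hpair : ∃ i j, i ≠ j ∧ w i ≠ 0 ∧ w j ≠ 0 ∧ ψ i j = 0
    · obtain ⟨i, j, hne, hi, hj, hij⟩ := hpair
      set r : V → ℝ := fun x => if x = i ∨ x = j then 0 else w x with hr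
      have hr0 : ∀ x, 0 ≤ r x := by
        intro x; simp only [hr]; split_ifs; exacts [le_refl _, hw x]
      have hwr : w = r + w i • Pi.single i 1 + w j • Pi.single j 1 := by
        funext x
        by_cases h1 : x = i
        · subst h1; simp [hr, hne]
        · by_cases h2 : x = j
          · subst h2; simp [hr, h1]
          · simp [hr, h1, h2]
      have hai : 0 < w i := lt_of_le_of_ne (hw i) (Ne.symm hi)
      have haj : 0 < w j := lt_of_le_of_ne (hw j) (Ne.symm hj)
      have hsum : ∀ a b : ℝ, ∑ x, (r + a • Pi.single i 1 + b • Pi.single j 1 : V → ℝ) x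
          = ∑ x, r x + a + b := by
        intro a b
        simp [Finset.sum_add_distrib, ← Finset.mul_sum]
      set s := w i + w j with hs
      have hsuppi : (Finset.univ.filter fun x =>
          (r + s • Pi.single i 1 + (0 : ℝ) • Pi.single j 1 : V → ℝ) x ≠ 0).card ≤ k := by
        have hlt : (Finset.univ.filter fun x =>
          (r + s • Pi.single i 1 + (0 : ℝ) • Pi.single j 1 : V → ℝ) x ≠ 0).card <
            (Finset.univ.filter fun x => w x ≠ 0).card := by
          refine Finset.card_lt_card (Finset.ssubset_iff_of_subset ?_ |>.2 ⟨j, by simp [hj], ?_⟩)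
          · intro x
            simp only [Finset.mem_filter, Finset.mem_univ, true_and]
            intro hx h0
            by_cases h1 : x = i
            · subst h1; exact hi h0
            · exact hx (by simp [hr, h1, h0])
          · simp [hr, hne.symm]
        omega
      have hsuppj : (Finset.univ.filter fun x =>
          (r + (0 : ℝ) • Pi.single i 1 + s • Pi.single j 1 : V → ℝ) x ≠ 0).card ≤ k := by
        have hlt : (Finset.univ.filter fun x =>
          (r + (0 : ℝ) • Pi.single i 1 + s • Pi.single j 1 : V → ℝ) x ≠ 0).card <
            (Finset.univ.filter fun x => w x ≠ 0).card := by
          refine Finset.card_lt_card (Finset.ssubset_iff_of_subset ?_ |>.2 ⟨i, by simp [hi], ?_⟩)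
          · intro x
            simp only [Finset.mem_filter, Finset.mem_univ, true_and]
            intro hx h0
            by_cases h1 : x = j
            · subst h1; exact hj h0
            · exact hx (by simp [hr, h1, h0])
          · simp [hr, hne]
        omega
      have hnn : ∀ a b : ℝ, 0 ≤ a → 0 ≤ b →
          ∀ x, 0 ≤ (r + a • Pi.single i 1 + b • Pi.single j 1 : V → ℝ) x := by
        intro a b ha hb x
        simp only [Pi.add_apply, Pi.smul_apply, smul_eq_mul]
        have e1 : 0 ≤ (Pi.single i (1 : ℝ) : V → ℝ) x := by
          by_cases h : x = i
          · subst h; simp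
          · simp [h]
        have e2 : 0 ≤ (Pi.single j (1 : ℝ) : V → ℝ) x := by
          by_cases h : x = j
          · subst h; simp
          · simp [h]
        have := hr0 x
        positivity
      have hs0 : 0 < s := by positivity
      have b1 := ih _ (hnn s 0 hs0.le le_rfl) hsuppi
      have b2 := ih _ (hnn 0 s le_rfl hs0.le) hsuppj
      have hws : ∑ x, w x = ∑ x, r x + s := by
        conv_lhs => rw [hwr]
        rw [hsum, hs]; ring
      have hww : tri ψ w w w = tri ψ (r + w i • Pi.single i 1 + w j • Pi.single j 1)
          (r + w i • Pi.single i 1 + w j • Pi.single j 1)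
          (r + w i • Pi.single i 1 + w j • Pi.single j 1) := by rw [← hwr]
      rw [hsum, tri_expand2 ψ hψ r i j hij] at b1 b2
      rw [hww, hws, tri_expand2 ψ hψ r i j hij]
      have hM : ∑ z, pat ψ i j z * r z + ∑ z, pat ψ j i z * r z ≤
          ∑ z, pat ψ i i z * r z + ∑ z, pat ψ j j z * r z := by
        rw [← Finset.sum_add_distrib, ← Finset.sum_add_distrib]
        refine Finset.sum_le_sum fun z _ => ?_
        have hji : ψ j i = 0 := by rw [hψ i j, hij, neg_zero]
        have hii := psi_self ψ hψ i
        have hjj := psi_self ψ hψ j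
        have := hr0 z
        simp only [pat, hij, hji, hii, hjj]
        by_cases c1 : ψ i z = 1 <;> by_cases c2 : ψ j z = 1 <;> simp [c1, c2, this]
      generalize (∑ z, pat ψ i j z * r z + ∑ z, pat ψ j i z * r z) = M at *
      generalize ∑ z, pat ψ i i z * r z = Mi at *
      generalize ∑ z, pat ψ j j z * r z = Mj at *
      generalize (tri ψ (Pi.single i 1) r r + tri ψ r (Pi.single i 1) r
        + tri ψ r r (Pi.single i 1)) = Li at *
      generalize (tri ψ (Pi.single j 1) r r + tri ψ r (Pi.single j 1) r
        + tri ψ r r (Pi.single j 1)) = Lj at *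
      generalize tri ψ r r r = Q at *
      rw [add_zero] at b1 b2
      generalize A * (∑ x, r x + s) ^ 3 = B at *
      generalize w i = a at *
      generalize w j = b at *
      have g1 : a * b * M ≤ a * b * (Mi + Mj) :=
        mul_le_mul_of_nonneg_left hM (by positivity)
      have g2 : s * (Q + a * Li + b * Lj + a ^ 2 * Mi + b ^ 2 * Mj + a * b * (Mi + Mj)) =
          a * (Q + s * Li + s ^ 2 * Mi) + b * (Q + s * Lj + s ^ 2 * Mj) := by
        rw [hs]; ring
      have g3 : s * (Q + a * Li + b * Lj + a ^ 2 * Mi + b ^ 2 * Mj + a * b * (Mi + Mj))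
          ≤ s * B := by
        rw [g2]
        have c1 : a * (Q + s * Li + s ^ 2 * Mi) ≤ a * B :=
          mul_le_mul_of_nonneg_left (by linarith) hai.le
        have c2 : b * (Q + s * Lj + s ^ 2 * Mj) ≤ b * B :=
          mul_le_mul_of_nonneg_left (by linarith) haj.le
        have c3 : s * B = a * B + b * B := by rw [hs]; ring
        linarith
      have g4 := le_of_mul_le_mul_left g3 hs0
      linarith
    · push Not at hpair
      by_cases hemp : ∀ x, w x = 0
      · rw [tri_zero_of]
        · have : 0 ≤ ∑ x, w x := Finset.sum_nonneg fun x _ => hw x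
          positivity
        · intro x y z hx; exact absurd (hemp x) hx
      push Not at hemp
      obtain ⟨x0, hx0⟩ := hemp
      obtain ⟨i, -, hmax⟩ := Finset.exists_max_image Finset.univ w ⟨x0, Finset.mem_univ _⟩
      have hai : 0 < w i := lt_of_lt_of_le (lt_of_le_of_ne (hw x0) (Ne.symm hx0))
        (hmax x0 (Finset.mem_univ _))
      set r : V → ℝ := fun x => if x = i then 0 else w x with hr
      have hr0 : ∀ x, 0 ≤ r x := by
        intro x; simp only [hr]; split_ifs; exacts [le_refl _, hw x]
      have hri : ∀ x, r x ≠ 0 → x ≠ i ∧ w x ≠ 0 := by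
        intro x hx
        simp only [hr] at hx
        split_ifs at hx with h
        · exact absurd rfl hx
        · exact ⟨h, hx⟩
      have hwr : w = r + w i • Pi.single i 1 + (0 : ℝ) • Pi.single i 1 := by
        funext x
        by_cases h1 : x = i
        · subst h1; simp [hr]
        · simp [hr, h1]
      have hsuppr : (Finset.univ.filter fun x => r x ≠ 0).card ≤ k := by
        have hlt : (Finset.univ.filter fun x => r x ≠ 0).card <
            (Finset.univ.filter fun x => w x ≠ 0).card := by
          refine Finset.card_lt_card (Finset.ssubset_iff_of_subset ?_ |>.2
            ⟨i, by simp [hai.ne'], by simp [hr]⟩)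
          intro x
          simp only [Finset.mem_filter, Finset.mem_univ, true_and]
          exact fun hx => (hri x hx).2
        omega
      have b1 := ih r hr0 hsuppr
      have hws : ∑ x, w x = ∑ x, r x + w i := by
        conv_lhs => rw [hwr]
        simp [Finset.sum_add_distrib, ← Finset.mul_sum]
      have hww : tri ψ w w w = tri ψ (r + w i • Pi.single i 1 + (0 : ℝ) • Pi.single i 1)
          (r + w i • Pi.single i 1 + (0 : ℝ) • Pi.single i 1)
          (r + w i • Pi.single i 1 + (0 : ℝ) • Pi.single i 1) := by rw [← hwr]
      rw [hww, hws, tri_expand2 ψ hψ r i i (psi_self ψ hψ i)]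
      have t1 : tri ψ (Pi.single i 1) r r = 0 := by
        refine tri_zero_of ψ _ _ _ fun x y z hx hy _ => ?_
        rw [single_ne hx]
        have := hpair i y (hri y hy).1.symm hai.ne' (hri y hy).2
        simp [pat, this]
      have t2 : tri ψ r (Pi.single i 1) r = 0 := by
        refine tri_zero_of ψ _ _ _ fun x y z hx hy _ => ?_
        rw [single_ne hy]
        have := hpair x i (hri x hx).1 (hri x hx).2 hai.ne'
        simp [pat, this]
      have t3 : tri ψ r r (Pi.single i 1) = ∑ x, pat ψ x x i * r x ^ 2 := by
        unfold tri
        refine Finset.sum_congr rfl fun x _ => ?_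
        rw [Finset.sum_eq_single x, Finset.sum_eq_single i]
        · simp; ring
        · intro b _ hb; simp [hb]
        · simp
        · intro y _ hy
          refine Finset.sum_eq_zero fun z _ => ?_
          by_cases hx0 : r x = 0
          · simp [hx0]
          by_cases hy0 : r y = 0
          · simp [hy0]
          have := hpair x y hy.symm (hri x hx0).2 (hri y hy0).2
          simp [pat, this]
        · simp
      have t4 : w i * (∑ x, pat ψ x x i * r x ^ 2) + w i ^ 2 * (∑ z, pat ψ i i z * r z)
          ≤ w i ^ 2 * ∑ x, r x := by
        rw [Finset.mul_sum, Finset.mul_sum, Finset.mul_sum, ← Finset.sum_add_distrib]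
        refine Finset.sum_le_sum fun x _ => ?_
        have hx0 := hr0 x
        have hxle : r x ≤ w i := by
          simp only [hr]; split_ifs
          · exact hai.le
          · exact hmax x (Finset.mem_univ _)
        have hxx := psi_self ψ hψ x
        have hii := psi_self ψ hψ i
        have k1 : w i * r x ^ 2 ≤ w i ^ 2 * r x := by
          have : w i * r x * r x ≤ w i * r x * w i :=
            mul_le_mul_of_nonneg_left hxle (by positivity)
          nlinarith
        have k2 : 0 ≤ w i ^ 2 * r x := by positivity
        have k3 : ψ x i = 1 → ψ i x = 1 → False := by
          intro e1 e2
          rw [hψ x i, e1] at e2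
          revert e2; decide
        by_cases c1 : ψ x i = 1
        · by_cases c2 : ψ i x = 1
          · exact (k3 c1 c2).elim
          · simp [pat, c1, c2, hxx, k1]
        · by_cases c2 : ψ i x = 1
          · simp [pat, c1, c2, hii]
          · simp [pat, c1, c2, k2]
      rw [t1, t2, t3]
      have := hquad (w i) (∑ x, r x) hai.le (Finset.sum_nonneg fun x _ => hr0 x)
      have e0 : w i ^ 2 * ∑ z, pat ψ i i z * r z + 0 ^ 2 * ∑ z, pat ψ i i z * r z =
        w i ^ 2 * ∑ z, pat ψ i i z * r z := by ring
      nlinarith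

end

/-! ### Exact bound on small vertex sets, and averaging -/

/-- the constant `√3/3 - 1/2` -/
noncomputable def alph : ℝ := Real.sqrt 3 / 3 - 1 / 2

lemma alph_eq : 12 * alph ^ 2 + 12 * alph = 1 := by
  have h : Real.sqrt 3 ^ 2 = 3 := Real.sq_sqrt (by norm_num)
  unfold alph
  nlinarith

lemma alph_pos : 0 < alph := by
  have h : (1.5 : ℝ) < Real.sqrt 3 := Real.lt_sqrt_of_sq_lt (by norm_num)
  unfold alph
  linarith

lemma alph_lt : alph < 1 / 12 := by
  have := alph_eq
  have := alph_pos
  nlinarith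

lemma alph_quad (a s : ℝ) (ha : 0 ≤ a) (_hs : 0 ≤ s) :
    a ^ 2 * s + 2 * alph * s ^ 3 ≤ 2 * alph * (s + a) ^ 3 := by
  have h1 := alph_eq
  have h2 := alph_pos
  -- reduces to `a * s ≤ 2α (3 s² + 3 s a + a²)`
  have key : a * s ≤ 2 * alph * (3 * s ^ 2 + 3 * s * a + a ^ 2) := by
    have h3 : 0 ≤ (12 * alph * s - (1 - 6 * alph) * a) ^ 2 := sq_nonneg _
    have h4 : 24 * alph * (2 * alph * (3 * s ^ 2 + 3 * s * a + a ^ 2) - a * s) =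
        (12 * alph * s - (1 - 6 * alph) * a) ^ 2 := by
      linear_combination (a ^ 2) * h1
    rw [← h4] at h3
    have := nonneg_of_mul_nonneg_right h3 (by positivity)
    linarith
  have := mul_le_mul_of_nonneg_left key ha
  nlinarith

lemma zmod3_cases (a : ZMod 3) : a = 0 ∨ a = 1 ∨ a = 2 := by
  revert a; decide

lemma card_sub_le {V : Type} [DecidableEq V] (H : Finset (Finset V))
    (hH : ∀ e ∈ H, e.card = 3) (ℓ : ℕ)
    (hP : ∀ m : ℕ, 3 ≤ m → m ≤ ℓ → ¬ (3 ∣ m) → ¬ HasPseudocycle H m)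
    (S : Finset V) (hS : S.card ^ 2 ≤ ℓ) :
    ((H.filter fun e => e ⊆ S).card : ℝ) ≤ alph * (S.card : ℝ) ^ 3 := by
  obtain ⟨ψ, hψ, hstep⟩ := exists_orientation H hH ℓ hP S hS
  have hbound := tri_le ψ hψ (2 * alph) (by have := alph_pos; positivity) alph_quad
    _ (fun _ => 1) (fun _ => zero_le_one) le_rfl
  simp only [Finset.sum_const, Finset.card_univ, Fintype.card_coe, nsmul_eq_mul, mul_one] at hbound
  set T : Finset (S × S × S) := Finset.univ.filter fun t =>
    ψ t.1 t.2.2 = 1 ∧ ψ t.2.1 t.2.2 = 1 ∧ ψ t.1 t.2.1 = 0 with hT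
  have htri : tri ψ (fun _ => 1) (fun _ => 1) (fun _ => 1) = (T.card : ℝ) := by
    rw [hT, Finset.card_filter]
    push_cast
    simp only [Fintype.sum_prod_type, tri, pat, mul_one]
  -- each edge has an appropriate ordering
  have hedge : ∀ e : {e // e ∈ H.filter fun e => e ⊆ S}, ∃ t : S × S × S,
      t.1 ≠ t.2.1 ∧ ({t.1.1, t.2.1.1, t.2.2.1} : Finset V) = e.1 ∧
      ψ t.1 t.2.2 = 1 ∧ ψ t.2.1 t.2.2 = 1 ∧ ψ t.1 t.2.1 = 0 := by
    rintro ⟨e, he⟩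
    rw [Finset.mem_filter] at he
    obtain ⟨heH, heS⟩ := he
    obtain ⟨x, y, z, hxy, hxz, hyz, rfl⟩ := Finset.card_eq_three.1 (hH e heH)
    have hx : x ∈ S := heS (by simp)
    have hy : y ∈ S := heS (by simp)
    have hz : z ∈ S := heS (by simp)
    have p1 : ({y, z, x} : Finset V) = {x, y, z} := by ext a; simp; tauto
    have p2 : ({z, x, y} : Finset V) = {x, y, z} := by ext a; simp; tauto
    have s1 := hstep ⟨x, hx⟩ ⟨y, hy⟩ ⟨z, hz⟩ heH
    have s2 := hstep ⟨y, hy⟩ ⟨z, hz⟩ ⟨x, hx⟩ (by simpa only [p1] using heH)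
    have s3 := hstep ⟨z, hz⟩ ⟨x, hx⟩ ⟨y, hy⟩ (by simpa only [p2] using heH)
    have q1 := hψ ⟨x, hx⟩ ⟨y, hy⟩
    have q2 := hψ ⟨y, hy⟩ ⟨z, hz⟩
    have q3 := hψ ⟨z, hz⟩ ⟨x, hx⟩
    rcases zmod3_cases (ψ ⟨x, hx⟩ ⟨y, hy⟩) with h | h | h
    · refine ⟨(⟨x, hx⟩, ⟨y, hy⟩, ⟨z, hz⟩), by simpa using hxy, rfl, ?_, ?_, h⟩
      · simp only; rw [q3, s2, s1, h]; decide
      · simp only; rw [s1, h]; decide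
    · refine ⟨(⟨z, hz⟩, ⟨x, hx⟩, ⟨y, hy⟩), by simpa using hxz.symm, p2, ?_, ?_, ?_⟩
      · simp only; rw [q2, s1, h]; decide
      · simp only; rw [h]
      · simp only; rw [s2, s1, h]; decide
    · refine ⟨(⟨y, hy⟩, ⟨z, hz⟩, ⟨x, hx⟩), by simpa using hyz, p1, ?_, ?_, ?_⟩
      · simp only; rw [q1, h]; decide
      · simp only; rw [s2, s1, h]; decide
      · simp only; rw [s1, h]; decide
  choose t ht using hedge
  have hcard : 2 * (H.filter fun e => e ⊆ S).card ≤ T.card := by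
    have : Fintype.card ({e // e ∈ H.filter fun e => e ⊆ S} × Bool) ≤ T.card := by
      rw [← Finset.card_univ]
      refine Finset.card_le_card_of_injOn
        (fun q => if q.2 then t q.1 else ((t q.1).2.1, (t q.1).1, (t q.1).2.2)) ?_ ?_
      · rintro ⟨e, b⟩ -
        obtain ⟨h1, h2, h3, h4, h5⟩ := ht e
        cases b
        · have h6 : ψ (t e).2.1 (t e).1 = 0 := by rw [hψ, h5, neg_zero]
          simp [hT, h3, h4, h6]
        · simp [hT, h3, h4, h5]
      · rintro ⟨e, b⟩ - ⟨e', b'⟩ - h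
        have h1 := ht e
        have h2 := ht e'
        have swap : ∀ x y z : V, ({y, x, z} : Finset V) = {x, y, z} := by
          intro x y z; ext a; simp; tauto
        cases b <;> cases b' <;> simp only [if_true, Bool.false_eq_true, if_false] at h
        · have e1 : (t e).2.1 = (t e').2.1 := congrArg (fun q => q.1) h
          have e2 : (t e).1 = (t e').1 := congrArg (fun q => q.2.1) h
          have e3 : (t e).2.2 = (t e').2.2 := congrArg (fun q => q.2.2) h
          have : e = e' := Subtype.ext (by rw [← h1.2.1, ← h2.2.1, e1, e2, e3])
          rw [this]
        · have e1 : (t e).2.1 = (t e').1 := congrArg (fun q => q.1) h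
          have e2 : (t e).1 = (t e').2.1 := congrArg (fun q => q.2.1) h
          have e3 : (t e).2.2 = (t e').2.2 := congrArg (fun q => q.2.2) h
          have : e = e' := Subtype.ext (by rw [← h1.2.1, ← h2.2.1, e1, e2, e3, swap])
          subst this
          exact absurd e1.symm h1.1
        · have e1 : (t e').2.1 = (t e).1 := congrArg (fun q => q.1) h.symm
          have e2 : (t e').1 = (t e).2.1 := congrArg (fun q => q.2.1) h.symm
          have e3 : (t e').2.2 = (t e).2.2 := congrArg (fun q => q.2.2) h.symm
          have : e = e' := Subtype.ext (by rw [← h1.2.1, ← h2.2.1, e1, e2, e3, swap])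
          subst this
          exact absurd e1.symm h1.1
        · have : e = e' := Subtype.ext (by rw [← h1.2.1, ← h2.2.1, h])
          rw [this]
    simpa [Fintype.card_prod, mul_comm] using this
  rw [htri] at hbound
  have hc : (2 : ℝ) * ((H.filter fun e => e ⊆ S).card : ℝ) ≤ (T.card : ℝ) := by
    exact_mod_cast hcard
  linarith

lemma cast_choose_three (n : ℕ) (hn : 3 ≤ n) :
    ((n.choose 3 : ℕ) : ℝ) = (n : ℝ) * (n - 1) * (n - 2) / 6 := by
  obtain ⟨k, rfl⟩ := Nat.exists_eq_add_of_le hn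
  have h6 : (3 + k).descFactorial 3 = Nat.factorial 3 * (3 + k).choose 3 :=
    Nat.descFactorial_eq_factorial_mul_choose _ _
  have h7 : (3 + k).descFactorial 3 = (k + 1) * ((k + 2) * (k + 3)) := by
    have a1 : 3 + k - 2 = k + 1 := by omega
    have a2 : 3 + k - 1 = k + 2 := by omega
    simp [Nat.descFactorial, a1, a2]
    ring
  rw [h7] at h6
  have h8 : (((k + 1) * ((k + 2) * (k + 3)) : ℕ) : ℝ) = ((6 * (3 + k).choose 3 : ℕ) : ℝ) := by
    rw [h6]; rfl
  push_cast at h8 ⊢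
  linarith

lemma density_bound {V : Type} [DecidableEq V] [Fintype V] (H : Finset (Finset V))
    (hH : ∀ e ∈ H, e.card = 3) (ℓ : ℕ)
    (hP : ∀ m : ℕ, 3 ≤ m → m ≤ ℓ → ¬ (3 ∣ m) → ¬ HasPseudocycle H m)
    (N : ℕ) (hN : 3 ≤ N) (hNℓ : N ^ 2 ≤ ℓ) (hNV : N ≤ Fintype.card V) :
    (H.card : ℝ) * ((N - 1) * (N - 2)) ≤ alph * N ^ 2 * (Fintype.card V : ℝ) ^ 3 := by
  set n := Fintype.card V with hn
  have hdouble : ∑ S ∈ (Finset.univ : Finset V).powersetCard N, (H.filter fun e => e ⊆ S).card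
      = H.card * (n - 3).choose (N - 3) := by
    simp only [Finset.card_filter]
    rw [Finset.sum_comm]
    rw [Finset.sum_congr rfl (g := fun _ => (n - 3).choose (N - 3))]
    · simp
    · intro e he
      rw [← Finset.card_filter]
      rw [Finset.card_filter_powersetCard_subset e Finset.univ N (Finset.subset_univ _)
        (by rw [hH e he]; exact hN), hH e he, Finset.card_univ]
  have hle : (∑ S ∈ (Finset.univ : Finset V).powersetCard N,
      ((H.filter fun e => e ⊆ S).card : ℝ)) ≤ (n.choose N : ℝ) * (alph * (N : ℝ) ^ 3) := by
    have : ∀ S ∈ (Finset.univ : Finset V).powersetCard N,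
        ((H.filter fun e => e ⊆ S).card : ℝ) ≤ alph * (N : ℝ) ^ 3 := by
      intro S hS
      have hSc := (Finset.mem_powersetCard.1 hS).2
      have := card_sub_le H hH ℓ hP S (by rw [hSc]; exact hNℓ)
      rwa [hSc] at this
    refine (Finset.sum_le_card_nsmul _ _ _ this).trans ?_
    rw [Finset.card_powersetCard, Finset.card_univ, nsmul_eq_mul]
  have hd' : (∑ S ∈ (Finset.univ : Finset V).powersetCard N,
      ((H.filter fun e => e ⊆ S).card : ℝ)) = (H.card : ℝ) * ((n - 3).choose (N - 3) : ℝ) := by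
    exact_mod_cast hdouble
  rw [hd'] at hle
  have hch : (n.choose N : ℝ) * (N.choose 3 : ℝ) = (n.choose 3 : ℝ) * ((n - 3).choose (N - 3) : ℝ) := by
    exact_mod_cast Nat.choose_mul (n := n) (k := N) (s := 3) hN
  have hpos : (0 : ℝ) < ((n - 3).choose (N - 3) : ℝ) := by
    exact_mod_cast Nat.choose_pos (by omega)
  have hα := alph_pos
  have h1 : (H.card : ℝ) * (N.choose 3 : ℝ) ≤ alph * (N : ℝ) ^ 3 * (n.choose 3 : ℝ) := by
    have h2 := mul_le_mul_of_nonneg_right hle (Nat.cast_nonneg (α := ℝ) (N.choose 3))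
    refine le_of_mul_le_mul_right ?_ hpos
    calc (H.card : ℝ) * (N.choose 3 : ℝ) * ((n - 3).choose (N - 3) : ℝ)
        = (H.card : ℝ) * ((n - 3).choose (N - 3) : ℝ) * (N.choose 3 : ℝ) := by ring
      _ ≤ (n.choose N : ℝ) * (alph * (N : ℝ) ^ 3) * (N.choose 3 : ℝ) := h2
      _ = alph * (N : ℝ) ^ 3 * ((n.choose N : ℝ) * (N.choose 3 : ℝ)) := by ring
      _ = _ := by rw [hch]; ring
  rw [cast_choose_three N hN, cast_choose_three n (hN.trans hNV)] at h1
  have hN0 : (3 : ℝ) ≤ N := by exact_mod_cast hN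
  have hn0 : (3 : ℝ) ≤ n := by exact_mod_cast hN.trans hNV
  have h3 : (n : ℝ) * (n - 1) * (n - 2) ≤ (n : ℝ) ^ 3 := by nlinarith
  have h4 : alph * (N : ℝ) ^ 3 * ((n : ℝ) * (n - 1) * (n - 2) / 6) ≤
      alph * (N : ℝ) ^ 3 * ((n : ℝ) ^ 3 / 6) :=
    mul_le_mul_of_nonneg_left (by linarith) (by positivity)
  have h5 := h1.trans h4
  refine le_of_mul_le_mul_left ?_ (show (0 : ℝ) < N / 6 by positivity)
  calc (N : ℝ) / 6 * ((H.card : ℝ) * ((N - 1) * (N - 2)))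
      = (H.card : ℝ) * ((N : ℝ) * (N - 1) * (N - 2) / 6) := by ring
    _ ≤ _ := h5
    _ = _ := by ring

/-! ### Lower bound on `f` -/

lemma f_ge (n k : ℕ) (hk : 1 ≤ k) (hkn : k < n) : k.choose 2 * (n - k) + f (n - k) ≤ f n := by
  obtain ⟨m, rfl⟩ : ∃ m, n = m + 2 := ⟨n - 2, by omega⟩
  have hfe : f (m + 2) = (Finset.range (m + 1)).sup fun j =>
      Nat.choose (j + 1) 2 * (m + 1 - j) + f (m + 1 - j) := by
    rw [f]
  rw [hfe]
  have h := Finset.le_sup (f := fun j => Nat.choose (j + 1) 2 * (m + 1 - j) + f (m + 1 - j))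
    (show k - 1 ∈ Finset.range (m + 1) by rw [Finset.mem_range]; omega)
  have e1 : k - 1 + 1 = k := by omega
  have e2 : m + 1 - (k - 1) = m + 2 - k := by omega
  simp only [e1, e2] at h
  exact h

lemma f_lower (n : ℕ) : alph * (n : ℝ) ^ 3 - (n : ℝ) ^ 2 ≤ (f n : ℝ) := by
  induction n using Nat.strong_induction_on with
  | _ n ih =>
    have hα := alph_pos
    have hα' := alph_lt
    rcases Nat.lt_or_ge n 12 with hn | hn
    · have h1 : (n : ℝ) ≤ 12 := by exact_mod_cast hn.le
      have h2 : (0 : ℝ) ≤ f n := Nat.cast_nonneg _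
      have h3 : (0 : ℝ) ≤ n := Nat.cast_nonneg _
      have h4 : alph * (n : ℝ) ≤ 1 := by nlinarith
      have h5 : (n : ℝ) ^ 2 * (alph * n) ≤ (n : ℝ) ^ 2 * 1 :=
        mul_le_mul_of_nonneg_left h4 (by positivity)
      nlinarith
    · have hs3 : Real.sqrt 3 ^ 2 = 3 := Real.sq_sqrt (by norm_num)
      have hs1 : (1.7 : ℝ) < Real.sqrt 3 := Real.lt_sqrt_of_sq_lt (by norm_num)
      have hs2 : Real.sqrt 3 < 1.8 := by
        rw [Real.sqrt_lt' (by norm_num)]; norm_num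
      set x : ℝ := (3 - Real.sqrt 3) / 2 with hx
      have hx1 : 0.6 < x := by rw [hx]; linarith
      have hx2 : x < 0.65 := by rw [hx]; linarith
      have hcub : x ^ 2 * (1 - x) / 2 + alph * (1 - x) ^ 3 = alph := by
        have e : Real.sqrt 3 = 3 - 2 * x := by rw [hx]; ring
        have e2 : 2 * x ^ 2 = 6 * x - 3 := by
          rw [e] at hs3; linarith
        have e3 : alph = 1 / 2 - 2 * x / 3 := by
          unfold alph; rw [e]; ring
        rw [e3]
        linear_combination (x ^ 2 / 3 - x / 2) * e2
      have hn0 : (12 : ℝ) ≤ n := by exact_mod_cast hn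
      set k : ℕ := ⌊x * n⌋₊ with hk
      have hk1 : (k : ℝ) ≤ x * n := Nat.floor_le (by positivity)
      have hk2 : x * n < k + 1 := Nat.lt_floor_add_one _
      have hkn : k < n := by
        have : (k : ℝ) < n := by nlinarith
        exact_mod_cast this
      have hkpos : 1 ≤ k := by
        have : (0 : ℝ) < k := by nlinarith
        exact_mod_cast this
      have hf := f_ge n k hkpos hkn
      have hf' : (k : ℝ) * (k - 1) / 2 * (n - k) + (f (n - k) : ℝ) ≤ f n := by
        have : ((k.choose 2 * (n - k) + f (n - k) : ℕ) : ℝ) ≤ f n := by exact_mod_cast hf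
        push_cast [Nat.cast_choose_two, Nat.cast_sub hkn.le] at this
        exact this
      have hi := ih (n - k) (by omega)
      rw [Nat.cast_sub hkn.le] at hi
      generalize (f (n - k) : ℝ) = F at *
      generalize (f n : ℝ) = G at *
      have hkR : (1 : ℝ) ≤ k := by exact_mod_cast hkpos
      generalize (k : ℝ) = κ at *
      generalize (n : ℝ) = ν at *
      have hd1 : (1 - x) * ν ≤ ν - κ := by linarith
      have hd2 : ν - κ ≤ ν / 2 := by nlinarith
      have hd0 : 0 ≤ (1 - x) * ν := mul_nonneg (by linarith) (by linarith)
      have g1 : (x * ν) ^ 2 - 3 * (x * ν) ≤ κ * (κ - 1) := by nlinarith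
      have g2 : κ * (κ - 1) / 2 * ((1 - x) * ν) ≤ κ * (κ - 1) / 2 * (ν - κ) :=
        mul_le_mul_of_nonneg_left hd1 (by nlinarith)
      have g3 : ((x * ν) ^ 2 - 3 * (x * ν)) / 2 * ((1 - x) * ν)
          ≤ κ * (κ - 1) / 2 * ((1 - x) * ν) :=
        mul_le_mul_of_nonneg_right (by linarith) hd0
      have g4 : alph * ((1 - x) * ν) ^ 3 ≤ alph * (ν - κ) ^ 3 :=
        mul_le_mul_of_nonneg_left (pow_le_pow_left₀ hd0 hd1 3) hα.le
      have g5 : (ν - κ) ^ 2 ≤ (ν / 2) ^ 2 := pow_le_pow_left₀ (by linarith) hd2 2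
      have g6 : 3 / 2 * (x * (1 - x)) * ν ^ 2 ≤ 3 / 8 * ν ^ 2 :=
        mul_le_mul_of_nonneg_right (by nlinarith [sq_nonneg (x - 1 / 2)]) (by positivity)
      have g7 : ((x * ν) ^ 2 - 3 * (x * ν)) / 2 * ((1 - x) * ν) + alph * ((1 - x) * ν) ^ 3
          = alph * ν ^ 3 - 3 / 2 * (x * (1 - x)) * ν ^ 2 := by
        linear_combination ν ^ 3 * hcub
      have g8 : 0 ≤ ν ^ 2 := by positivity
      nlinarith

/-! ### Cloning a vertex -/

/-- the projection identifying all clones with `u` -/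
def cl {n : ℕ} (u : Fin n) (t : ℕ) : Fin n ⊕ Fin t → Fin n := Sum.elim id (fun _ => u)

/-- the hypergraph with `t` extra clones of `u` -/
def cloneH {n : ℕ} (H : Finset (Finset (Fin n))) (u : Fin n) (t : ℕ) :
    Finset (Finset (Fin n ⊕ Fin t)) :=
  Finset.univ.filter fun e => e.card = 3 ∧ e.image (cl u t) ∈ H

lemma cloneH_pseudo {n : ℕ} (H : Finset (Finset (Fin n))) (u : Fin n) (t m : ℕ)
    (h : HasPseudocycle (cloneH H u t) m) : HasPseudocycle H m := by
  obtain ⟨v, hv⟩ := h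
  refine ⟨fun i => cl u t (v i), fun i => ?_⟩
  have := (Finset.mem_filter.1 (hv i)).2.2
  simpa [Finset.image_insert] using this

lemma cloneH_card {n : ℕ} (H : Finset (Finset (Fin n))) (hH : ∀ e ∈ H, e.card = 3)
    (u : Fin n) (t : ℕ) :
    H.card + t * (H.filter fun e => u ∈ e).card ≤ (cloneH H u t).card := by
  classical
  have : Fintype.card ({e // e ∈ H} ⊕ (Fin t × {e // e ∈ H.filter fun e => u ∈ e}))
      ≤ (cloneH H u t).card := by
    rw [← Finset.card_univ]
    refine Finset.card_le_card_of_injOn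
      (Sum.elim (fun e => e.1.image Sum.inl)
        (fun q => insert (Sum.inr q.1) ((q.2.1.erase u).image Sum.inl))) ?_ ?_
    · rintro (⟨e, he⟩ | ⟨j, ⟨e, he⟩⟩) -
      · simp only [cloneH, Sum.elim_inl, Finset.coe_filter, Finset.mem_univ, true_and,
          Set.mem_ofPred_eq]
        refine ⟨?_, ?_⟩
        · rw [Finset.card_image_of_injective _ Sum.inl_injective, hH e he]
        · rw [Finset.image_image]
          have : (cl u t ∘ Sum.inl) = id := by funext x; rfl
          rw [this, Finset.image_id]; exact he
      · rw [Finset.mem_filter] at he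
        simp only [cloneH, Sum.elim_inr, Finset.coe_filter, Finset.mem_univ, true_and,
          Set.mem_ofPred_eq]
        refine ⟨?_, ?_⟩
        · rw [Finset.card_insert_of_notMem (by simp),
            Finset.card_image_of_injective _ Sum.inl_injective, Finset.card_erase_of_mem he.2,
            hH e he.1]
        · rw [Finset.image_insert, Finset.image_image]
          have : (cl u t ∘ Sum.inl) = id := by funext x; rfl
          rw [this, Finset.image_id]
          have : cl u t (Sum.inr j) = u := rfl
          rw [this, Finset.insert_erase he.2]; exact he.1
    · rintro (⟨e, he⟩ | ⟨j, ⟨e, he⟩⟩) - (⟨e', he'⟩ | ⟨j', ⟨e', he'⟩⟩) - h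
      · simp only [Sum.elim_inl] at h
        have := Finset.image_injective Sum.inl_injective h
        subst this; rfl
      · exfalso
        simp only [Sum.elim_inl, Sum.elim_inr] at h
        have : (Sum.inr j' : Fin n ⊕ Fin t) ∈ e.image Sum.inl := by rw [h]; simp
        simp at this
      · exfalso
        simp only [Sum.elim_inl, Sum.elim_inr] at h
        have : (Sum.inr j : Fin n ⊕ Fin t) ∈ e'.image Sum.inl := by rw [← h]; simp
        simp at this
      · simp only [Sum.elim_inr] at h
        rw [Finset.mem_filter] at he he'
        have hj : j = j' := by
          have : (Sum.inr j : Fin n ⊕ Fin t) ∈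
            insert (Sum.inr j') ((e'.erase u).image Sum.inl) := by rw [← h]; simp
          simpa using this
        subst hj
        have h2 : e.erase u = e'.erase u := by
          ext x
          have := Finset.ext_iff.1 h (Sum.inl x)
          simpa using this
        have h3 : e = e' := by
          rw [← Finset.insert_erase he.2, ← Finset.insert_erase he'.2, h2]
        subst h3; rfl
  rw [Fintype.card_sum, Fintype.card_prod, Fintype.card_fin, Fintype.card_coe,
    Fintype.card_coe] at this
  exact this

theorem max_degree_of_near_extremal :
    ∃ ε₂' : ℝ, 0 < ε₂' ∧ ∀ ε₂ : ℝ, 0 < ε₂ → ε₂ < ε₂' →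
      ∃ ε₁' : ℝ, 0 < ε₁' ∧ ∀ ε₁ : ℝ, 0 < ε₁ → ε₁ < ε₁' →
        ∃ ℓ₀ : ℕ, ∀ ℓ : ℕ, ℓ₀ ≤ ℓ →
          ∃ n₀ : ℕ, ∀ n : ℕ, n₀ ≤ n →
            ∀ H : Finset (Finset (Fin n)), (∀ e ∈ H, e.card = 3) →
              (∀ m : ℕ, 3 ≤ m → m ≤ ℓ → ¬ (3 ∣ m) → ¬ HasPseudocycle H m) →
              (H.card : ℝ) ≥ (f n : ℝ) - ε₁ * (n : ℝ) ^ 3 →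
              ∀ u : Fin n,
                ((H.filter fun e => u ∈ e).card : ℝ)
                  ≤ (3 * (Real.sqrt 3 / 3 - 1 / 2) + ε₂) * (n : ℝ) ^ 2 := by
  refine ⟨1, one_pos, fun ε₂ hε₂ hε₂1 => ⟨ε₂ ^ 2 / 24, by positivity, fun ε₁ hε₁ hε₁' => ?_⟩⟩
  set η : ℝ := ε₂ ^ 2 / 100 with hη
  have hη0 : 0 < η := by positivity
  have hη1 : η < 1 / 100 := by rw [hη]; nlinarith
  have hα := alph_pos
  have hα' := alph_lt
  obtain ⟨N, hN⟩ := exists_nat_gt (6 / η)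
  have hNη : 6 < N * η := (div_lt_iff₀ hη0).1 hN
  have hN3 : 3 ≤ N := by
    have : (3 : ℝ) ≤ N := by nlinarith
    exact_mod_cast this
  refine ⟨N ^ 2, fun ℓ hℓ => ?_⟩
  obtain ⟨M, hM⟩ := exists_nat_gt (24 / ε₂ ^ 2)
  refine ⟨max N M, fun n hn H hH hP hcard u => ?_⟩
  have hnN : N ≤ n := (le_max_left _ _).trans hn
  have hnM : (M : ℝ) ≤ n := by exact_mod_cast (le_max_right _ _).trans hn
  have hnε : 24 < n * ε₂ ^ 2 := (div_lt_iff₀ (by positivity)).1 (hM.trans_le hnM)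
  change _ ≤ (3 * alph + ε₂) * (n : ℝ) ^ 2
  by_contra hcon
  push Not at hcon
  set t : ℕ := ⌊ε₂ * n⌋₊ with ht
  have hnpos : (0 : ℝ) < n := by
    have : (3 : ℝ) ≤ n := by exact_mod_cast hN3.trans hnN
    linarith
  have ht1 : (t : ℝ) ≤ ε₂ * n := Nat.floor_le (by positivity)
  have ht2 : ε₂ * n < t + 1 := Nat.lt_floor_add_one _
  have hdens := density_bound (cloneH H u t) (fun e he => (Finset.mem_filter.1 he).2.1) ℓ
    (fun m h1 h2 h3 h4 => hP m h1 h2 h3 (cloneH_pseudo H u t m h4)) N hN3 hℓ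
    (by simp; omega)
  have hcl : (H.card : ℝ) + t * ((H.filter fun e => u ∈ e).card : ℝ) ≤ (cloneH H u t).card := by
    exact_mod_cast cloneH_card H hH u t
  have hfl := f_lower n
  simp only [Fintype.card_sum, Fintype.card_fin, Nat.cast_add] at hdens
  generalize ((cloneH H u t).card : ℝ) = E' at *
  generalize ((H.filter fun e => u ∈ e).card : ℝ) = d at *
  generalize (H.card : ℝ) = E at *
  generalize (f n : ℝ) = F at *
  have hN3' : (3 : ℝ) ≤ N := by exact_mod_cast hN3
  have ht0 : (0 : ℝ) ≤ t := Nat.cast_nonneg _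
  generalize (t : ℝ) = τ at *
  generalize (n : ℝ) = ν at *
  generalize (N : ℝ) = K at *
  -- upper bound on the clone
  have hup : E' ≤ (alph + η) * (ν + τ) ^ 3 := by
    have h1 : alph * K ^ 2 ≤ (alph + η) * ((K - 1) * (K - 2)) := by nlinarith
    have h2 : alph * K ^ 2 * (ν + τ) ^ 3 ≤ (alph + η) * ((K - 1) * (K - 2)) * (ν + τ) ^ 3 :=
      mul_le_mul_of_nonneg_right h1 (by positivity)
    refine le_of_mul_le_mul_right ?_ (show 0 < (K - 1) * (K - 2) from
      mul_pos (by linarith) (by linarith))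
    linarith
  have hτd : τ * ((3 * alph + ε₂) * ν ^ 2) ≤ τ * d := mul_le_mul_of_nonneg_left hcon.le ht0
  have hε : ε₂ ^ 2 < ε₂ := by nlinarith
  -- `τ ≥ ε₂ ν / 2`
  have hτ2 : ε₂ * ν / 2 ≤ τ := by nlinarith
  have hτν : τ ≤ ν := by nlinarith
  have main : alph * ν ^ 3 - ν ^ 2 - ε₁ * ν ^ 3 + τ * ((3 * alph + ε₂) * ν ^ 2)
      ≤ (alph + η) * (ν + τ) ^ 3 := by linarith
  have c1 : (ν + τ) ^ 3 ≤ 8 * ν ^ 3 := by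
    have := pow_le_pow_left₀ (by linarith : 0 ≤ ν + τ) (by linarith : ν + τ ≤ 2 * ν) 3
    linarith
  have c2 : η * (ν + τ) ^ 3 ≤ η * (8 * ν ^ 3) := mul_le_mul_of_nonneg_left c1 hη0.le
  have c3 : alph * (3 * ν * τ ^ 2 + τ ^ 3) ≤ ν * τ * (ε₂ * ν) / 3 := by
    have e1 : τ ^ 3 ≤ ν * τ ^ 2 := by
      have := mul_le_mul_of_nonneg_right hτν (sq_nonneg τ)
      linarith
    have e2 : alph * (3 * ν * τ ^ 2 + τ ^ 3) ≤ 1 / 12 * (4 * ν * τ ^ 2) :=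
      mul_le_mul hα'.le (by linarith) (by positivity) (by norm_num)
    have e3 : ν * τ * τ ≤ ν * τ * (ε₂ * ν) := mul_le_mul_of_nonneg_left ht1 (by positivity)
    linarith
  have c4 : (ε₂ * ν ^ 2) * (ε₂ * ν / 2) ≤ (ε₂ * ν ^ 2) * τ :=
    mul_le_mul_of_nonneg_left hτ2 (by positivity)
  have c5 : ν ^ 2 * 24 ≤ ν ^ 2 * (ν * ε₂ ^ 2) := mul_le_mul_of_nonneg_left hnε.le (by positivity)
  have c6 : ε₁ * ν ^ 3 ≤ ε₂ ^ 2 / 24 * ν ^ 3 :=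
    mul_le_mul_of_nonneg_right hε₁'.le (by positivity)
  have c7 : 0 < ε₂ ^ 2 * ν ^ 3 := by positivity
  have c8 : η * (8 * ν ^ 3) = 8 / 100 * (ε₂ ^ 2 * ν ^ 3) := by rw [hη]; ring
  have main2 : τ * (ε₂ * ν ^ 2) ≤ alph * (3 * ν * τ ^ 2 + τ ^ 3) + η * (ν + τ) ^ 3 + ν ^ 2
      + ε₁ * ν ^ 3 := by linarith
  linarith
end
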